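/- Let θ be a CPWL function, let φ₀ and Φ be twice continuously differentiable around x̄ in the composite optimization setting with v̄ ∈ Λ_com(x̄), and assume 0 ∈ aff ∂θ(z̄), where aff denotes the affine hull. If the KKT solution map S_KKT is Lipschitz-like around ((0,0),(x̄,v̄)), then: (i) the nondegeneracy condition aff ∂θ(z̄) ∩ ker ∇Φ(x̄)* = {0} holds; and (ii) Λ_com(x̄) = {v̄} and v̄ is a noncritical multiplier. -/

import Mathlib

open Filter Topology Set RealInnerProductSpace

noncomputable section

abbrev Ev (k : ℕ) := EuclideanSpace ℝ (Fin k)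

/-- The Bouligand–Severi tangent cone to a set `s` at `x`. -/
def tcone {E : Type*} [NormedAddCommGroup E] [NormedSpace ℝ E] (s : Set E) (x : E) : Set E :=
  {w | ∃ (z : ℕ → E) (c : ℕ → ℝ), (∀ k, z k ∈ s) ∧ (∀ k, 0 ≤ c k) ∧
      Tendsto z atTop (𝓝 x) ∧ Tendsto (fun k => c k • (z k - x)) atTop (𝓝 w)}

/-- The data of a convex piecewise linear (CPWL) extended-real-valued function on `ℝ^m`:
`θ(z) = max_i (⟨a i, z⟩ - al i)` on the polyhedron `dom θ = {z | ⟨d i, z⟩ ≤ be i ∀ i}`,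
and `θ(z) = +∞` outside of it. -/
structure CPWL (m : ℕ) where
  l : ℕ
  p : ℕ
  hl : 0 < l
  a : Fin l → Ev m
  al : Fin l → ℝ
  d : Fin p → Ev m
  be : Fin p → ℝ
  dom_nonempty : ∃ z : Ev m, ∀ i, ⟪d i, z⟫ ≤ be i

namespace CPWL

variable {m : ℕ} (θ : CPWL m)

/-- The (polyhedral) domain of the CPWL function. -/
def dom : Set (Ev m) := {z | ∀ i, ⟪θ.d i, z⟫ ≤ θ.be i}

/-- The real value `max_i (⟨a i, z⟩ - al i)` of the CPWL function (meaningful on its domain). -/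
def val (z : Ev m) : ℝ := ⨆ i : Fin θ.l, (⟪θ.a i, z⟫ - θ.al i)

/-- The CPWL function as an extended-real-valued function. -/
def eval (z : Ev m) : EReal :=
  @ite _ (z ∈ θ.dom) (Classical.propDecidable _) ((θ.val z : ℝ) : EReal) ⊤

/-- The subdifferential (of convex analysis) of the CPWL function. -/
def subdiff (z : Ev m) : Set (Ev m) :=
  {v | z ∈ θ.dom ∧ ∀ z' ∈ θ.dom, ⟪v, z' - z⟫ ≤ θ.val z' - θ.val z}

/-- Active indices `K(z)` of the max-representation. -/
def Kact (z : Ev m) : Set (Fin θ.l) := {i | θ.val z = ⟪θ.a i, z⟫ - θ.al i}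

/-- Active indices `I(z)` of the domain constraints. -/
def Iact (z : Ev m) : Set (Fin θ.p) := {i | ⟪θ.d i, z⟫ = θ.be i}

/-- The critical cone `𝒦(z̄,v̄) = {w ∈ T(z̄; dom θ) : ⟨v̄,w⟩ = θ′(z̄;w)}`. -/
def crit (zb vb : Ev m) : Set (Ev m) :=
  {w | w ∈ tcone θ.dom zb ∧
    Tendsto (fun t : ℝ => (θ.val (zb + t • w) - θ.val zb) / t) (𝓝[>] (0 : ℝ))
      (𝓝 ⟪vb, w⟫)}

/-- The graph of the subdifferential mapping. -/
def gph : Set (Ev m × Ev m) := {zv | zv.2 ∈ θ.subdiff zv.1}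

/-- The graphical derivative `(D∂θ)(z̄,v̄)(u)`. -/
def Dsub (zb vb u : Ev m) : Set (Ev m) := {w | (u, w) ∈ tcone θ.gph (zb, vb)}

/-- The regular coderivative `(D̂*∂θ)(z̄,v̄)(u)`. -/
def Dhat (zb vb u : Ev m) : Set (Ev m) :=
  {w | ∀ h ∈ tcone θ.gph (zb, vb), ⟪w, h.1⟫ - ⟪u, h.2⟫ ≤ 0}

end CPWL

section VarSys

variable {n m : ℕ}

/-- The adjoint `∇Φ(x)*` of the Jacobian of `Φ` at `x`. -/
def adjD (Φ : Ev n → Ev m) (x : Ev n) : Ev m →L[ℝ] Ev n :=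
  ContinuousLinearMap.adjoint (fderiv ℝ Φ x)

/-- `Ψ(x,v) = f(x) + ∇Φ(x)* v`. -/
def Psi (f : Ev n → Ev n) (Φ : Ev n → Ev m) (x : Ev n) (v : Ev m) : Ev n :=
  f x + adjD Φ x v

/-- The partial Jacobian `∇ₓΨ(x̄,v̄)`. -/
def gradxPsi (f : Ev n → Ev n) (Φ : Ev n → Ev m) (xb : Ev n) (vb : Ev m) :
    Ev n →L[ℝ] Ev n :=
  fderiv ℝ (fun x => Psi f Φ x vb) xb

/-- The Lagrange multiplier set `Λ(x̄)` of the variational system. -/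
def Lam (f : Ev n → Ev n) (Φ : Ev n → Ev m) (θ : CPWL m) (xb : Ev n) : Set (Ev m) :=
  {v | Psi f Φ xb v = 0 ∧ v ∈ θ.subdiff (Φ xb)}

/-- `v̄` is a critical multiplier for the variational system. -/
def IsCritical (f : Ev n → Ev n) (Φ : Ev n → Ev m) (θ : CPWL m) (xb : Ev n) (vb : Ev m) :
    Prop :=
  ∃ ξ : Ev n, ξ ≠ 0 ∧ ∃ w ∈ θ.Dsub (Φ xb) vb (fderiv ℝ Φ xb ξ),
    gradxPsi f Φ xb vb ξ + adjD Φ xb w = 0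

/-- The solution map of the canonically perturbed variational system. -/
def Smap (f : Ev n → Ev n) (Φ : Ev n → Ev m) (θ : CPWL m) (p₁ : Ev n) (p₂ : Ev m) :
    Set (Ev n × Ev m) :=
  {xv | Psi f Φ xv.1 xv.2 = p₁ ∧ xv.2 ∈ θ.subdiff (Φ xv.1 + p₂)}

end VarSys

section General

variable {n m : ℕ}

/-- The subdifferential of a general extended-real-valued function. -/
def subdiffE (θ : Ev m → EReal) (z : Ev m) : Set (Ev m) :=
  {v | ∀ z', ((⟪v, z' - z⟫ : ℝ) : EReal) ≤ θ z' - θ z}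

/-- The graph of the subdifferential of a general extended-real-valued function. -/
def gphE (θ : Ev m → EReal) : Set (Ev m × Ev m) := {zv | zv.2 ∈ subdiffE θ zv.1}

/-- The graphical derivative of the subdifferential, general case. -/
def DsubE (θ : Ev m → EReal) (zb vb u : Ev m) : Set (Ev m) :=
  {w | (u, w) ∈ tcone (gphE θ) (zb, vb)}

/-- The Lagrange multiplier set, general case. -/
def LamE (f : Ev n → Ev n) (Φ : Ev n → Ev m) (θ : Ev m → EReal) (xb : Ev n) :
    Set (Ev m) :=
  {v | Psi f Φ xb v = 0 ∧ v ∈ subdiffE θ (Φ xb)}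

/-- The solution map of the canonically perturbed variational system, general case. -/
def SmapE (f : Ev n → Ev n) (Φ : Ev n → Ev m) (θ : Ev m → EReal) (p₁ : Ev n)
    (p₂ : Ev m) : Set (Ev n × Ev m) :=
  {xv | Psi f Φ xv.1 xv.2 = p₁ ∧ xv.2 ∈ subdiffE θ (Φ xv.1 + p₂)}

end General

section Composite

variable {n m : ℕ}

/-- The gradient `∇ₓL(·,v)` of the Lagrangian `L(x,v) = φ₀(x) + ⟨Φ(x),v⟩`. -/
def gradL (φ₀ : Ev n → ℝ) (Φ : Ev n → Ev m) (v : Ev m) (x : Ev n) : Ev n :=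
  gradient (fun y => φ₀ y + ⟪Φ y, v⟫) x

/-- The Hessian `∇²ₓₓL(x̄,v)` as a linear operator. -/
def HessOp (φ₀ : Ev n → ℝ) (Φ : Ev n → Ev m) (v : Ev m) (xb : Ev n) : Ev n →L[ℝ] Ev n :=
  fderiv ℝ (gradL φ₀ Φ v) xb

/-- The Lagrange multiplier set `Λ_com(x̄)` of the composite optimization problem. -/
def LamCom (φ₀ : Ev n → ℝ) (Φ : Ev n → Ev m) (θ : CPWL m) (xb : Ev n) : Set (Ev m) :=
  {v | gradient φ₀ xb + adjD Φ xb v = 0 ∧ v ∈ θ.subdiff (Φ xb)}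

/-- Criticality of a multiplier in the composite optimization setting. -/
def IsCriticalCom (φ₀ : Ev n → ℝ) (Φ : Ev n → Ev m) (θ : CPWL m) (xb : Ev n) (v : Ev m) :
    Prop :=
  ∃ ξ : Ev n, ξ ≠ 0 ∧ ∃ w ∈ θ.Dsub (Φ xb) v (fderiv ℝ Φ xb ξ),
    HessOp φ₀ Φ v xb ξ + adjD Φ xb w = 0

/-- The solution map of the canonically perturbed KKT system of composite optimization. -/
def SKKT (φ₀ : Ev n → ℝ) (Φ : Ev n → Ev m) (θ : CPWL m) (p₁ : Ev n) (p₂ : Ev m) :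
    Set (Ev n × Ev m) :=
  {xv | gradient φ₀ xv.1 + adjD Φ xv.1 xv.2 = p₁ ∧ xv.2 ∈ θ.subdiff (Φ xv.1 + p₂)}

/-- `x̄` is a local minimizer of `φ₀ + θ∘Φ`. -/
def LocalMin (φ₀ : Ev n → ℝ) (Φ : Ev n → Ev m) (θ : CPWL m) (xb : Ev n) : Prop :=
  ∃ U ∈ 𝓝 xb, ∀ x ∈ U,
    ((φ₀ xb : ℝ) : EReal) + θ.eval (Φ xb) ≤ ((φ₀ x : ℝ) : EReal) + θ.eval (Φ x)

end Composite

section Calmness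

variable {n m : ℕ}

/-- Isolated calmness of a solution map at `((0,0), q0)`. -/
def IsolCalm (S : Ev n × Ev m → Set (Ev n × Ev m)) (q0 : Ev n × Ev m) : Prop :=
  ∃ c : ℝ, 0 ≤ c ∧ ∃ U ∈ 𝓝 (0 : Ev n × Ev m), ∃ V ∈ 𝓝 q0,
    ∀ p ∈ U, ∀ q ∈ S p ∩ V, ‖q - q0‖ ≤ c * (‖p.1‖ + ‖p.2‖)

/-- Robust isolated calmness of a solution map at `((0,0), q0)`. -/
def RobustIsolCalm (S : Ev n × Ev m → Set (Ev n × Ev m)) (q0 : Ev n × Ev m) : Prop :=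
  ∃ c : ℝ, 0 ≤ c ∧ ∃ U ∈ 𝓝 (0 : Ev n × Ev m), ∃ V ∈ 𝓝 q0,
    (∀ p ∈ U, ∀ q ∈ S p ∩ V, ‖q - q0‖ ≤ c * (‖p.1‖ + ‖p.2‖)) ∧
    (∀ p ∈ U, (S p ∩ V).Nonempty)

/-- The Lipschitz-like (Aubin) property of a solution map around `((0,0), q0)`. -/
def LipschitzLike (S : Ev n × Ev m → Set (Ev n × Ev m)) (q0 : Ev n × Ev m) : Prop :=
  ∃ c : ℝ, 0 ≤ c ∧ ∃ U ∈ 𝓝 (0 : Ev n × Ev m), ∃ V ∈ 𝓝 q0,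
    ∀ p ∈ U, ∀ p' ∈ U, ∀ q ∈ S p ∩ V, ∃ q' ∈ S p', ‖q - q'‖ ≤ c * ‖p - p'‖

end Calmness

theorem ev_aff (A B c : ℝ) (h : A ≤ B) (hc : A = B → c ≤ 0) :
    ∀ᶠ s in 𝓝[≥] (0:ℝ), A + s * c ≤ B := by
  rcases h.lt_or_eq with h | h
  · have : Tendsto (fun s : ℝ => A + s * c) (𝓝[≥] 0) (𝓝 (A + 0 * c)) :=
      ((continuous_const.add (continuous_id.mul continuous_const)).tendsto 0).mono_left
        nhdsWithin_le_nhds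
    have h2 : A + 0 * c < B := by simpa using h
    filter_upwards [this.eventually_lt_const h2] with s hs using hs.le
  · filter_upwards [self_mem_nhdsWithin] with s hs
    have h1 := hc h
    have : s * c ≤ 0 := mul_nonpos_of_nonneg_of_nonpos hs h1
    linarith

theorem fm_step {E : Type*} [AddCommGroup E] [Module ℝ E] (T : Set (E →ₗ[ℝ] ℝ)) (hT : T.Finite)
    (g : E) : ∃ T' : Set (E →ₗ[ℝ] ℝ), T'.Finite ∧
      ∀ x, (∃ r : ℝ, 0 ≤ r ∧ ∀ f ∈ T, f (x - r • g) ≤ 0) ↔ ∀ f ∈ T', f x ≤ 0 := by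
  classical
  refine ⟨{f ∈ T | f g ≤ 0} ∪ image2 (fun f h : E →ₗ[ℝ] ℝ => (f g) • h - (h g) • f)
    {f ∈ T | 0 < f g} {f ∈ T | f g < 0},
    (hT.subset (sep_subset _ _)).union ((hT.subset (sep_subset _ _)).image2 _
      (hT.subset (sep_subset _ _))), fun x => ⟨?_, ?_⟩⟩
  · rintro ⟨r, hr, h⟩ f (⟨hf, hfg⟩ | ⟨f1, ⟨hf1, hp⟩, f2, ⟨hf2, hn⟩, rfl⟩)
    · have := h f hf
      simp only [map_sub, map_smul, smul_eq_mul] at this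
      nlinarith [mul_nonneg hr (neg_nonneg.2 hfg)]
    · have h1 := h f1 hf1
      have h2 := h f2 hf2
      simp only [map_sub, map_smul, smul_eq_mul] at h1 h2
      simp only [LinearMap.sub_apply, LinearMap.smul_apply, smul_eq_mul]
      nlinarith
  · intro h
    let Lo : Finset ℝ := insert 0 ((hT.toFinset.filter (fun f => 0 < f g)).image
      (fun f => f x / f g))
    have hne : Lo.Nonempty := ⟨0, by simp [Lo]⟩
    refine ⟨Lo.max' hne, Lo.le_max' 0 (by simp [Lo]), fun f hf => ?_⟩
    simp only [map_sub, map_smul, smul_eq_mul]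
    rcases lt_trichotomy (f g) 0 with hg | hg | hg
    · have hm := Lo.max'_mem hne
      have hb : ∀ r ∈ Lo, f x - r * f g ≤ 0 := by
        intro r hr
        simp only [Lo, Finset.mem_insert, Finset.mem_image, Finset.mem_filter,
          Set.Finite.mem_toFinset] at hr
        rcases hr with rfl | ⟨f1, ⟨hf1, hp⟩, rfl⟩
        · have := h f (Or.inl ⟨hf, hg.le⟩)
          simpa using this
        · have := h _ (Or.inr ⟨f1, ⟨hf1, hp⟩, f, ⟨hf, hg⟩, rfl⟩)
          simp only [LinearMap.sub_apply, LinearMap.smul_apply, smul_eq_mul] at this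
          have e : f x - f1 x / f1 g * f g = (f1 g * f x - f g * f1 x) / f1 g := by
            field_simp
          rw [e]
          exact div_nonpos_of_nonpos_of_nonneg this hp.le
      exact hb _ hm
    · have := h f (Or.inl ⟨hf, hg.le⟩)
      simpa [hg] using this
    · have : f x / f g ≤ Lo.max' hne := Lo.le_max' _ (by
        simp only [Lo, Finset.mem_insert, Finset.mem_image, Finset.mem_filter,
          Set.Finite.mem_toFinset]
        exact Or.inr ⟨f, ⟨hf, hg⟩, rfl⟩)
      rw [div_le_iff₀ hg] at this
      linarith

theorem fm {E : Type*} [AddCommGroup E] [Module ℝ E] [FiniteDimensional ℝ E] (s : Set E)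
    (hs : s.Finite) : ∃ T : Set (E →ₗ[ℝ] ℝ), T.Finite ∧
      ∀ x, x ∈ Submodule.span NNReal s ↔ ∀ f ∈ T, f x ≤ 0 := by
  induction s, hs using Set.Finite.induction_on with
  | empty =>
    let b := Module.finBasis ℝ E
    refine ⟨range (fun i => b.coord i) ∪ range (fun i => - b.coord i),
      (finite_range _).union (finite_range _), fun x => ?_⟩
    simp only [Submodule.span_empty, Submodule.mem_bot]
    constructor
    · rintro rfl f _
      simp
    · intro h
      apply b.ext_elem
      intro i
      have h1 := h _ (Or.inl ⟨i, rfl⟩)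
      have h2 := h _ (Or.inr ⟨i, rfl⟩)
      simp only [LinearMap.neg_apply, Module.Basis.coord_apply] at h1 h2
      simp only [map_zero, Finsupp.coe_zero, Pi.zero_apply]
      linarith
  | @insert g s _ _ ih =>
    obtain ⟨T, hT, h⟩ := ih
    obtain ⟨T', hT', h'⟩ := fm_step T hT g
    refine ⟨T', hT', fun x => ?_⟩
    rw [← h', Submodule.mem_span_insert]
    constructor
    · rintro ⟨a, z, hz, rfl⟩
      refine ⟨a, a.2, ?_⟩
      rw [h] at hz
      have : a • g + z - (a:ℝ) • g = z := by
        rw [NNReal.smul_def]; abel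
      rw [this]; exact hz
    · rintro ⟨r, hr, hx⟩
      refine ⟨r.toNNReal, x - r • g, (h _).2 hx, ?_⟩
      rw [NNReal.smul_def, Real.coe_toNNReal r hr]
      simp

def IsPhd {E : Type*} [NormedAddCommGroup E] [NormedSpace ℝ E] (S : Set E) : Prop :=
  ∃ T : Set ((E →L[ℝ] ℝ) × ℝ), T.Finite ∧ S = {x | ∀ q ∈ T, q.1 x ≤ q.2}

theorem IsPhd.half {E : Type*} [NormedAddCommGroup E] [NormedSpace ℝ E] (f : E →L[ℝ] ℝ) (b : ℝ) :
    IsPhd {x | f x ≤ b} := ⟨{(f, b)}, finite_singleton _, by simp⟩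

theorem IsPhd.iInter {E : Type*} [NormedAddCommGroup E] [NormedSpace ℝ E] {ι : Sort*} [Finite ι]
    {S : ι → Set E} (h : ∀ i, IsPhd (S i)) : IsPhd (⋂ i, S i) := by
  choose T hT hS using h
  refine ⟨⋃ i, T i, finite_iUnion hT, ?_⟩
  ext x
  simp only [mem_iInter, mem_ofPred_eq, mem_iUnion]
  constructor
  · rintro h q ⟨i, hi⟩
    have := h i
    rw [hS i] at this
    exact this q hi
  · intro h i
    rw [hS i]
    exact fun q hq => h q ⟨i, hq⟩

theorem IsPhd.inter {E : Type*} [NormedAddCommGroup E] [NormedSpace ℝ E]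
    {S S' : Set E} (h : IsPhd S) (h' : IsPhd S') : IsPhd (S ∩ S') := by
  rw [inter_eq_iInter]
  exact IsPhd.iInter (by rintro (_|_) <;> assumption)

theorem IsPhd.isClosed {E : Type*} [NormedAddCommGroup E] [NormedSpace ℝ E]
    {S : Set E} (h : IsPhd S) : IsClosed S := by
  obtain ⟨T, _, rfl⟩ := h
  simp only [ofPred_forall]
  exact isClosed_iInter fun q => isClosed_iInter fun _ => isClosed_le q.1.continuous
    continuous_const

theorem IsPhd.tangent {E : Type*} [NormedAddCommGroup E] [NormedSpace ℝ E]
    {S : Set E} (h : IsPhd S) {x w : E} {z : ℕ → E} {c : ℕ → ℝ} (hz : ∀ k, z k ∈ S)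
    (hc : ∀ k, 0 ≤ c k) (hx : Tendsto z atTop (𝓝 x))
    (hw : Tendsto (fun k => c k • (z k - x)) atTop (𝓝 w)) :
    ∀ᶠ t in 𝓝[≥] (0:ℝ), x + t • w ∈ S := by
  have hxS : x ∈ S := h.isClosed.mem_of_tendsto hx (Eventually.of_forall hz)
  obtain ⟨T, hT, rfl⟩ := h
  simp only [mem_ofPred_eq]
  rw [hT.eventually_all]
  intro q hq
  have := ev_aff (q.1 x) q.2 (q.1 w) (hxS q hq) (by
    intro he
    have h1 : Tendsto (fun k => q.1 (c k • (z k - x))) atTop (𝓝 (q.1 w)) :=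
      (q.1.continuous.tendsto w).comp hw
    refine le_of_tendsto h1 (Eventually.of_forall fun k => ?_)
    have := hz k q hq
    simp only [map_smul, map_sub, smul_eq_mul]
    exact mul_nonpos_of_nonneg_of_nonpos (hc k) (by linarith))
  filter_upwards [this] with t ht
  simpa using ht

namespace CPWL
variable {m : ℕ} (θ : CPWL m)

theorem le_val (z : Ev m) (i) : ⟪θ.a i, z⟫ - θ.al i ≤ θ.val z :=
  le_ciSup (f := fun i => ⟪θ.a i, z⟫ - θ.al i) (finite_range _).bddAbove i

theorem val_le {z : Ev m} {r : ℝ} (h : ∀ i, ⟪θ.a i, z⟫ - θ.al i ≤ r) : θ.val z ≤ r := by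
  have : Nonempty (Fin θ.l) := ⟨⟨0, θ.hl⟩⟩
  exact ciSup_le h

def gen (q : Set (Fin θ.l) × Set (Fin θ.p)) : Set (Ev m × ℝ) :=
  (fun j => (θ.a j, (1:ℝ))) '' q.1 ∪ (fun i => (θ.d i, (0:ℝ))) '' q.2

def VV (q : Set (Fin θ.l) × Set (Fin θ.p)) : Set (Ev m) :=
  {v | (v, (1:ℝ)) ∈ Submodule.span NNReal (θ.gen q)}

def DD (q : Set (Fin θ.l) × Set (Fin θ.p)) : Set (Ev m) :=
  {z | z ∈ θ.dom ∧ q.1 ⊆ θ.Kact z ∧ q.2 ⊆ θ.Iact z}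

theorem isPoly_VV (q) : IsPhd (θ.VV q) := by
  obtain ⟨T, hT, h⟩ := fm (θ.gen q) (((toFinite _).image _).union ((toFinite _).image _))
  refine ⟨(fun f : (Ev m × ℝ) →ₗ[ℝ] ℝ =>
    ((f ∘ₗ LinearMap.inl ℝ (Ev m) ℝ).toContinuousLinearMap, - f (0, 1))) '' T, hT.image _, ?_⟩
  ext v
  simp only [VV, mem_ofPred_eq, h, forall_mem_image]
  refine forall₂_congr fun f _ => ?_
  have : ((v, (1:ℝ)) : Ev m × ℝ) = (v, 0) + (0, 1) := by simp
  rw [this, map_add]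
  simp only [LinearMap.coe_toContinuousLinearMap', LinearMap.comp_apply, LinearMap.inl_apply]
  constructor <;> intro h <;> linarith

theorem mem_Kact {z : Ev m} {j} :
    j ∈ θ.Kact z ↔ ∀ i, ⟪θ.a i, z⟫ - θ.al i ≤ ⟪θ.a j, z⟫ - θ.al j := by
  constructor
  · intro h i
    have h' : θ.val z = ⟪θ.a j, z⟫ - θ.al j := h
    rw [← h']; exact θ.le_val z i
  · intro h
    exact le_antisymm (θ.val_le h) (θ.le_val z j)

theorem isPoly_DD (q) : IsPhd (θ.DD q) := by
  have : θ.DD q = (⋂ i, {z | innerSL ℝ (θ.d i) z ≤ θ.be i}) ∩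
      ((⋂ j : q.1, ⋂ i, {z | innerSL ℝ (θ.a i - θ.a j) z ≤ θ.al i - θ.al j}) ∩
      (⋂ i : q.2, {z | innerSL ℝ (- θ.d i) z ≤ - θ.be i})) := by
    ext z
    simp only [DD, dom, mem_ofPred_eq, mem_inter_iff, mem_iInter, innerSL_apply_apply,
      Subtype.forall, inner_sub_left, inner_neg_left]
    refine and_congr_right fun hd => and_congr ?_ ?_
    · refine forall₂_congr fun j _ => ?_
      rw [mem_Kact]
      refine forall_congr' fun i => ?_
      constructor <;> intro h <;> linarith
    · refine forall₂_congr fun j _ => ?_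
      have := hd j
      simp only [Iact, mem_ofPred_eq]
      constructor
      · intro h; linarith
      · intro h; linarith
  rw [this]
  exact (IsPhd.iInter fun i => .half _ _).inter
    ((IsPhd.iInter fun j => IsPhd.iInter fun i => .half _ _).inter
      (IsPhd.iInter fun i => .half _ _))

theorem sub_of_mem {q} {z v : Ev m} (hz : z ∈ θ.DD q) (hv : v ∈ θ.VV q) : v ∈ θ.subdiff z := by
  refine ⟨hz.1, fun y hy => ?_⟩
  have key : ∀ g ∈ Submodule.span NNReal (θ.gen q),
      ⟪g.1, y - z⟫ ≤ g.2 * (θ.val y - θ.val z) := by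
    intro g hg
    induction hg using Submodule.span_induction with
    | mem g hg =>
      rcases hg with ⟨j, hj, rfl⟩ | ⟨i, hi, rfl⟩
      · have h1 : θ.val z = ⟪θ.a j, z⟫ - θ.al j := hz.2.1 hj
        have h2 := θ.le_val y j
        simp only [inner_sub_right]
        linarith
      · have h1 : ⟪θ.d i, z⟫ = θ.be i := hz.2.2 hi
        have h2 := hy i
        simp only [inner_sub_right]
        linarith
    | zero => simp
    | add x y _ _ h1 h2 =>
      simp only [Prod.fst_add, Prod.snd_add, inner_add_left, add_mul]
      linarith
    | smul a x _ h =>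
      simp only [NNReal.smul_def, Prod.smul_fst, Prod.smul_snd, inner_smul_left, smul_eq_mul]
      rw [mul_assoc]
      exact mul_le_mul_of_nonneg_left h a.2
  simpa using key _ hv

theorem mem_of_sub {z v : Ev m} (hv : v ∈ θ.subdiff z) : v ∈ θ.VV (θ.Kact z, θ.Iact z) := by
  set q := (θ.Kact z, θ.Iact z) with hq
  obtain ⟨T, hT, h⟩ := fm (θ.gen q) (((toFinite _).image _).union ((toFinite _).image _))
  simp only [VV, mem_ofPred_eq]
  rw [h]
  intro f hf
  set hh : Ev m := (InnerProductSpace.toDual ℝ (Ev m)).symm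
    ((f ∘ₗ LinearMap.inl ℝ (Ev m) ℝ).toContinuousLinearMap) with hhd
  set η := f (0, 1) with hη
  have frep : ∀ (x : Ev m) (r : ℝ), f (x, r) = ⟪x, hh⟫ + r * η := by
    intro x r
    have : ((x, r) : Ev m × ℝ) = (x, 0) + r • (0, 1) := by simp
    rw [this, map_add, map_smul, real_inner_comm, hhd, InnerProductSpace.toDual_symm_apply]
    simp [hη]
  have hgen : ∀ g ∈ θ.gen q, f g ≤ 0 := fun g hg => (h g).1 (Submodule.subset_span hg) f hf
  have hev1 : ∀ᶠ s in 𝓝[≥] (0:ℝ), z + s • hh ∈ θ.dom := by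
    simp only [dom, mem_ofPred_eq]
    rw [eventually_all]
    intro i
    have := ev_aff ⟪θ.d i, z⟫ (θ.be i) ⟪θ.d i, hh⟫ (hv.1 i) (by
      intro he
      have := hgen _ (Or.inr ⟨i, he, rfl⟩)
      rw [frep] at this
      simpa using this)
    filter_upwards [this] with s hs
    rw [inner_add_right, inner_smul_right]
    exact hs
  have hev2 : ∀ᶠ s in 𝓝[≥] (0:ℝ), θ.val (z + s • hh) ≤ θ.val z - s * η := by
    have : ∀ᶠ s in 𝓝[≥] (0:ℝ), ∀ i, ⟪θ.a i, z⟫ - θ.al i + s * (⟪θ.a i, hh⟫ + η) ≤ θ.val z := by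
      rw [eventually_all]
      intro i
      refine ev_aff _ _ _ (θ.le_val z i) ?_
      intro he
      have := hgen _ (Or.inl ⟨i, he.symm, rfl⟩)
      rw [frep] at this
      simpa using this
    filter_upwards [this] with s hs
    refine θ.val_le fun i => ?_
    have := hs i
    rw [inner_add_right, inner_smul_right]
    linarith
  have hle : 𝓝[>] (0:ℝ) ≤ 𝓝[≥] 0 := nhdsWithin_mono _ Ioi_subset_Ici_self
  obtain ⟨s, ⟨h1, h2⟩, hs⟩ := (((hev1.and hev2).filter_mono hle).and self_mem_nhdsWithin).exists
  have h3 := hv.2 _ h1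
  rw [add_sub_cancel_left, inner_smul_right] at h3
  rw [frep]
  have hs' : 0 < s := hs
  have : s * (⟪v, hh⟫ + 1 * η) ≤ 0 := by linarith
  exact nonpos_of_mul_nonpos_right this hs'

theorem mem_gph_iff (y : Ev m × Ev m) : y ∈ θ.gph ↔ ∃ q, y.1 ∈ θ.DD q ∧ y.2 ∈ θ.VV q := by
  constructor
  · intro h
    exact ⟨(θ.Kact y.1, θ.Iact y.1), ⟨h.1, subset_rfl, subset_rfl⟩, θ.mem_of_sub h⟩
  · rintro ⟨q, h1, h2⟩
    exact θ.sub_of_mem h1 h2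

theorem loc (z1 v1 : Ev m) : ∀ᶠ y in 𝓝 (z1, v1), y ∈ θ.gph →
    v1 ∈ θ.subdiff y.1 ∧ y.2 ∈ θ.subdiff z1 := by
  have : ∀ᶠ y in 𝓝 (z1, v1), ∀ q, y ∈ θ.DD q ×ˢ θ.VV q → (z1, v1) ∈ θ.DD q ×ˢ θ.VV q := by
    rw [eventually_all]
    intro q
    by_cases h : (z1, v1) ∈ θ.DD q ×ˢ θ.VV q
    · exact Eventually.of_forall fun _ _ => h
    · have hc : IsClosed (θ.DD q ×ˢ θ.VV q) :=
        (θ.isPoly_DD q).isClosed.prod (θ.isPoly_VV q).isClosed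
      filter_upwards [hc.isOpen_compl.mem_nhds h] with y hy hy'
      exact absurd hy' hy
  filter_upwards [this] with y hy hg
  obtain ⟨q, h1, h2⟩ := (θ.mem_gph_iff y).1 hg
  obtain ⟨h3, h4⟩ := hy q ⟨h1, h2⟩
  exact ⟨θ.sub_of_mem h1 h4, θ.sub_of_mem h3 h2⟩

theorem tan {zb vb u w : Ev m} (h : (u, w) ∈ tcone θ.gph (zb, vb)) :
    ∃ t0 : ℝ, 0 < t0 ∧ ∀ s ∈ Icc 0 t0, ∀ t ∈ Icc 0 t0, vb + t • w ∈ θ.subdiff (zb + s • u) := by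
  obtain ⟨y, c, hy, hc, hx, hw⟩ := h
  have : ∃ q, ∃ᶠ k in atTop, (y k).1 ∈ θ.DD q ∧ (y k).2 ∈ θ.VV q := by
    by_contra hcon
    push Not at hcon
    have h2 := eventually_all.2 hcon
    obtain ⟨k, hk⟩ := h2.exists
    obtain ⟨q, h1, h2⟩ := (θ.mem_gph_iff (y k)).1 (hy k)
    exact hk q h1 h2
  obtain ⟨q, hq⟩ := this
  obtain ⟨σ, hσ, hm⟩ := extraction_of_frequently_atTop hq
  have hx' := hx.comp hσ.tendsto_atTop
  have hw' := hw.comp hσ.tendsto_atTop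
  have e1 := (θ.isPoly_DD q).tangent (x := zb) (w := u) (z := fun k => (y (σ k)).1)
    (c := fun k => c (σ k)) (fun k => (hm k).1) (fun k => hc _)
    ((continuous_fst.tendsto _).comp hx') ((continuous_fst.tendsto _).comp hw')
  have e2 := (θ.isPoly_VV q).tangent (x := vb) (w := w) (z := fun k => (y (σ k)).2)
    (c := fun k => c (σ k)) (fun k => (hm k).2) (fun k => hc _)
    ((continuous_snd.tendsto _).comp hx') ((continuous_snd.tendsto _).comp hw')
  obtain ⟨t0, ht0, hsub⟩ := (mem_nhdsGE_iff_exists_Icc_subset).1 (e1.and e2)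
  exact ⟨t0, ht0, fun s hs t ht => θ.sub_of_mem (hsub hs).1 (hsub ht).2⟩

theorem mono {z1 v1 z2 v2 : Ev m} (h1 : v1 ∈ θ.subdiff z1) (h2 : v2 ∈ θ.subdiff z2) :
    0 ≤ ⟪v1 - v2, z1 - z2⟫ := by
  have e1 := h1.2 z2 h2.1
  have e2 := h2.2 z1 h1.1
  simp only [inner_sub_left, inner_sub_right] at *
  linarith

theorem convex_subdiff (z : Ev m) : Convex ℝ (θ.subdiff z) := by
  intro v1 h1 v2 h2 a b ha hb hab
  refine ⟨h1.1, fun y hy => ?_⟩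
  have e1 := h1.2 y hy
  have e2 := h2.2 y hy
  rw [inner_add_left, inner_smul_left, inner_smul_left]
  simp only [conj_trivial]
  have : θ.val y - θ.val z = a * (θ.val y - θ.val z) + b * (θ.val y - θ.val z) := by
    rw [← add_mul, hab, one_mul]
  rw [this]
  gcongr

end CPWL
theorem dir_lemma {m : ℕ} {C : Set (Ev m)} (hC : Convex ℝ C) {vb : Ev m} (hvb : vb ∈ C) {w : Ev m}
    (hw : w ∈ (affineSpan ℝ C).direction) :
    ∃ v ∈ C, ∃ ε : ℝ, 0 < ε ∧ v + ε • w ∈ C ∧ v - ε • w ∈ C := by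
  have hmid : ∀ x ∈ C, ∀ y ∈ C, (1/2:ℝ) • x + (1/2:ℝ) • y ∈ C := fun x hx y hy =>
    hC hx hy (by norm_num) (by norm_num) (by norm_num)
  have hshr : ∀ v ∈ C, ∀ w : Ev m, ∀ ε δ : ℝ, 0 < ε → |δ| ≤ ε → v + ε • w ∈ C → v - ε • w ∈ C →
      v + δ • w ∈ C := by
    intro v hv w ε δ hε hδ h1 h2
    obtain ⟨hδ1, hδ2⟩ := abs_le.1 hδ
    have := hC h1 h2 (a := (1 + δ / ε) / 2) (b := (1 - δ / ε) / 2)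
      (by have : -1 ≤ δ / ε := by rw [le_div_iff₀ hε]; linarith
          linarith)
      (by have : δ / ε ≤ 1 := by rw [div_le_iff₀ hε]; linarith
          linarith) (by ring)
    convert this using 1
    match_scalars
    · ring
    · field_simp
      ring
  rw [direction_affineSpan, vectorSpan_eq_span_vsub_set_right ℝ hvb] at hw
  induction hw using Submodule.span_induction with
  | mem x hx =>
    obtain ⟨c, hc, rfl⟩ := hx
    refine ⟨_, hmid c hc vb hvb, 1/2, by norm_num, ?_, ?_⟩
    · convert hc using 1
      simp only [vsub_eq_sub]
      module
    · convert hvb using 1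
      simp only [vsub_eq_sub]
      module
  | zero => exact ⟨vb, hvb, 1, one_pos, by simpa using hvb, by simpa using hvb⟩
  | add x y _ _ h1 h2 =>
    obtain ⟨v1, hv1, e1, he1, p1, q1⟩ := h1
    obtain ⟨v2, hv2, e2, he2, p2, q2⟩ := h2
    have he : 0 < min e1 e2 := lt_min he1 he2
    have ha : |min e1 e2| = min e1 e2 := abs_of_pos he
    have a1 := hshr v1 hv1 x e1 (min e1 e2) he1 (by rw [ha]; exact min_le_left _ _) p1 q1
    have a2 := hshr v2 hv2 y e2 (min e1 e2) he2 (by rw [ha]; exact min_le_right _ _) p2 q2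
    have b1 := hshr v1 hv1 x e1 (-min e1 e2) he1 (by rw [abs_neg, ha]; exact min_le_left _ _) p1 q1
    have b2 := hshr v2 hv2 y e2 (-min e1 e2) he2 (by rw [abs_neg, ha]; exact min_le_right _ _) p2 q2
    refine ⟨_, hmid _ hv1 _ hv2, min e1 e2 / 2, by positivity, ?_, ?_⟩
    · convert hmid _ a1 _ a2 using 1
      module
    · convert hmid _ b1 _ b2 using 1
      module
  | smul a x _ h1 =>
    obtain ⟨v1, hv1, e1, he1, p1, q1⟩ := h1
    have hpos : 0 < |a| + 1 := by positivity
    have hb : |e1 / (|a| + 1) * a| ≤ e1 := by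
      rw [abs_mul, abs_div, abs_of_pos he1, abs_of_pos hpos, div_mul_eq_mul_div,
        div_le_iff₀ hpos]
      nlinarith [abs_nonneg a]
    refine ⟨v1, hv1, e1 / (|a| + 1), by positivity, ?_, ?_⟩
    · have := hshr v1 hv1 x e1 _ he1 hb p1 q1
      rwa [smul_smul]
    · have := hshr v1 hv1 x e1 (-(e1 / (|a| + 1) * a)) he1 (by rwa [abs_neg]) p1 q1
      rwa [smul_smul, sub_eq_add_neg, ← neg_smul]

section Calcul
variable {n m : ℕ}

theorem diff_grad {φ₀ : Ev n → ℝ} {xb : Ev n} (hphi : ContDiffAt ℝ 2 φ₀ xb) :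
    DifferentiableAt ℝ (gradient φ₀) xb := by
  have h : DifferentiableAt ℝ (fderiv ℝ φ₀) xb :=
    (hphi.fderiv_right (m := 1) (by norm_num)).differentiableAt (by norm_num)
  exact ((InnerProductSpace.toDual ℝ (Ev n)).symm.toContinuousLinearEquiv.differentiableAt).comp xb h

theorem diff_adj {Φ : Ev n → Ev m} {xb : Ev n} (hPhi : ContDiffAt ℝ 2 Φ xb) :
    DifferentiableAt ℝ (adjD Φ) xb := by
  have h : DifferentiableAt ℝ (fderiv ℝ Φ) xb :=
    (hPhi.fderiv_right (m := 1) (by norm_num)).differentiableAt (by norm_num)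
  exact ((ContinuousLinearMap.adjoint (𝕜 := ℝ) (E := Ev n) (F := Ev m)).toContinuousLinearEquiv.differentiableAt).comp xb h

theorem gradL_eq {φ₀ : Ev n → ℝ} {Φ : Ev n → Ev m} {x : Ev n} (v : Ev m)
    (h1 : DifferentiableAt ℝ φ₀ x) (h2 : DifferentiableAt ℝ Φ x) :
    gradL φ₀ Φ v x = gradient φ₀ x + adjD Φ x v := by
  have hv : HasFDerivAt (fun y => ⟪Φ y, v⟫) ((innerSL ℝ v) ∘L fderiv ℝ Φ x) x := by
    have := (innerSL ℝ v).hasFDerivAt.comp x h2.hasFDerivAt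
    have e : (fun y => ⟪Φ y, v⟫) = (innerSL ℝ v) ∘ Φ := by
      ext y
      simp [real_inner_comm]
    rw [e]
    exact this
  have := (h1.hasFDerivAt.add hv)
  unfold gradL
  apply HasGradientAt.gradient
  rw [hasGradientAt_iff_hasFDerivAt]
  have e : (InnerProductSpace.toDual ℝ (Ev n)) (gradient φ₀ x + (adjD Φ x) v) =
      fderiv ℝ φ₀ x + (innerSL ℝ) v ∘L fderiv ℝ Φ x := by
    ext1 y
    simp [adjD, ContinuousLinearMap.adjoint_inner_left, gradient, inner_add_left]
  rw [e]
  exact this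

theorem hess_eq {φ₀ : Ev n → ℝ} {Φ : Ev n → Ev m} {xb : Ev n} (v : Ev m)
    (hphi : ContDiffAt ℝ 2 φ₀ xb) (hPhi : ContDiffAt ℝ 2 Φ xb) (η : Ev n) :
    HessOp φ₀ Φ v xb η = fderiv ℝ (gradient φ₀) xb η + fderiv ℝ (adjD Φ) xb η v := by
  have he : gradL φ₀ Φ v =ᶠ[𝓝 xb] fun x => gradient φ₀ x + adjD Φ x v := by
    filter_upwards [hphi.eventually (by simp), hPhi.eventually (by simp)] with x h1 h2
    exact gradL_eq v (h1.differentiableAt (by norm_num)) (h2.differentiableAt (by norm_num))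
  unfold HessOp
  rw [he.fderiv_eq]
  have := ((diff_grad hphi).hasFDerivAt.add
    ((diff_adj hPhi).hasFDerivAt.clm_apply (hasFDerivAt_const v xb))).fderiv
  erw [this]
  simp

theorem hess_symm {φ₀ : Ev n → ℝ} {Φ : Ev n → Ev m} {xb : Ev n} (v : Ev m)
    (hphi : ContDiffAt ℝ 2 φ₀ xb) (hPhi : ContDiffAt ℝ 2 Φ xb) (ξ η : Ev n) :
    ⟪HessOp φ₀ Φ v xb ξ, η⟫ = ⟪ξ, HessOp φ₀ Φ v xb η⟫ := by
  have hf : ContDiffAt ℝ 2 (fun y => φ₀ y + ⟪Φ y, v⟫) xb :=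
    hphi.add (hPhi.inner ℝ contDiffAt_const)
  have hs := hf.isSymmSndFDerivAt (by simp)
  have h : DifferentiableAt ℝ (fderiv ℝ (fun y => φ₀ y + ⟪Φ y, v⟫)) xb :=
    (hf.fderiv_right (m := 1) (by norm_num)).differentiableAt (by norm_num)
  have key : ∀ ξ η, ⟪HessOp φ₀ Φ v xb ξ, η⟫ =
      fderiv ℝ (fderiv ℝ (fun y => φ₀ y + ⟪Φ y, v⟫)) xb ξ η := by
    intro ξ η
    have h2 := ((InnerProductSpace.toDual ℝ (Ev n)).symm.toContinuousLinearEquiv.hasFDerivAt.comp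
      xb h.hasFDerivAt).fderiv
    have h3 : HessOp φ₀ Φ v xb ξ = (InnerProductSpace.toDual ℝ (Ev n)).symm
        (fderiv ℝ (fderiv ℝ (fun y => φ₀ y + ⟪Φ y, v⟫)) xb ξ) := by
      unfold HessOp
      exact congrArg (fun L : Ev n →L[ℝ] Ev n => L ξ) h2
    rw [h3, InnerProductSpace.toDual_symm_apply]
  rw [key, real_inner_comm, key]
  exact hs _ _
end Calcul
theorem key_lemma {n m : ℕ} (θ : CPWL m) (φ₀ : Ev n → ℝ) (Φ : Ev n → Ev m)
    (xb : Ev n) (vb : Ev m)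
    (hphi : ContDiffAt ℝ 2 φ₀ xb) (hPhi : ContDiffAt ℝ 2 Φ xb)
    (hvb : vb ∈ LamCom φ₀ Φ θ xb)
    (hll : LipschitzLike (fun p => SKKT φ₀ Φ θ p.1 p.2) (xb, vb))
    (ξ : Ev n) (w : Ev m) (hξw : HessOp φ₀ Φ vb xb ξ + adjD Φ xb w = 0)
    (hnear : ∃ᶠ y in 𝓝 (Φ xb, vb), y ∈ θ.gph ∧ ∀ᶠ y' in 𝓝 y, y' ∈ θ.gph →
      ⟪w, y'.1 - y.1⟫ = 0 ∧ ⟪fderiv ℝ Φ xb ξ, y'.2 - y.2⟫ = 0) : ξ = 0 ∧ w = 0 := by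
  obtain ⟨c, hc, U, hU, V, hV, hS⟩ := hll
  set M : ℝ := ‖((ξ, -w) : Ev n × Ev m)‖ with hM
  have hM0 : 0 ≤ M := norm_nonneg _
  set A := adjD Φ with hA
  set g := gradient φ₀ with hg
  set A' := fderiv ℝ A xb with hA'
  have dA : HasFDerivAt A A' xb := (diff_adj hPhi).hasFDerivAt
  have dg : HasFDerivAt g (fderiv ℝ g xb) xb := (diff_grad hphi).hasFDerivAt
  have dPhi : HasFDerivAt Φ (fderiv ℝ Φ xb) xb := (hPhi.differentiableAt (by norm_num)).hasFDerivAt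
  set C : ℝ := c * M * (‖w‖ + ‖ξ‖ * (1 + (‖vb‖ + 1) + 1 + ‖A'‖)) with hC
  have main : ∀ κ : ℝ, 0 < κ → κ < 1 → ‖w‖ ^ 2 + ‖ξ‖ ^ 2 ≤ κ * C := by
    intro κ hκ hκ1
    -- choose the base point
    have c1 : ∀ᶠ y : Ev m × Ev m in 𝓝 (Φ xb, vb), ‖y.2 - vb‖ < κ := by
      have : Tendsto (fun y : Ev m × Ev m => ‖y.2 - vb‖) (𝓝 (Φ xb, vb)) (𝓝 ‖vb - vb‖) :=
        Continuous.tendsto (by fun_prop) _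
      exact this.eventually_lt_const (by simpa using hκ)
    have c2 : ∀ᶠ y : Ev m × Ev m in 𝓝 (Φ xb, vb), (g xb + A xb y.2, y.1 - Φ xb) ∈ interior U := by
      have : Tendsto (fun y : Ev m × Ev m => (g xb + A xb y.2, y.1 - Φ xb)) (𝓝 (Φ xb, vb))
          (𝓝 (g xb + A xb vb, Φ xb - Φ xb)) := Continuous.tendsto (by fun_prop) _
      rw [hvb.1, sub_self] at this
      exact this.eventually (isOpen_interior.mem_nhds (mem_interior_iff_mem_nhds.2 hU))
    have c3 : ∀ᶠ y : Ev m × Ev m in 𝓝 (Φ xb, vb), (xb, y.2) ∈ V := by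
      have : Tendsto (fun y : Ev m × Ev m => (xb, y.2)) (𝓝 (Φ xb, vb))
          (𝓝 (xb, vb)) := Continuous.tendsto (by fun_prop) _
      exact this.eventually hV
    obtain ⟨⟨z1, v1⟩, ⟨hgph, hloc⟩, h1, h2, h3⟩ :=
      (hnear.and_eventually (c1.and (c2.and c3))).exists
    simp only at h1 h2 h3
    set p : Ev n × Ev m := (g xb + A xb v1, z1 - Φ xb) with hp
    -- choose eps
    have hev : ∀ᶠ q : Ev n × Ev m in 𝓝 (xb, v1),
        ‖Φ q.1 - Φ xb - fderiv ℝ Φ xb (q.1 - xb)‖ ≤ κ * ‖q.1 - xb‖ ∧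
        ‖g q.1 - g xb - fderiv ℝ g xb (q.1 - xb)‖ ≤ κ * ‖q.1 - xb‖ ∧
        ‖A q.1 - A xb - A' (q.1 - xb)‖ ≤ κ * ‖q.1 - xb‖ ∧ ‖A q.1 - A xb‖ < κ := by
      have ht : Tendsto (fun q : Ev n × Ev m => q.1) (𝓝 (xb, v1)) (𝓝 xb) :=
        Continuous.tendsto (by fun_prop) _
      refine ht.eventually (p := fun x => ‖Φ x - Φ xb - fderiv ℝ Φ xb (x - xb)‖ ≤ κ * ‖x - xb‖ ∧
        ‖g x - g xb - fderiv ℝ g xb (x - xb)‖ ≤ κ * ‖x - xb‖ ∧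
        ‖A x - A xb - A' (x - xb)‖ ≤ κ * ‖x - xb‖ ∧ ‖A x - A xb‖ < κ) ?_
      refine (dPhi.isLittleO.def hκ).and ((dg.isLittleO.def hκ).and
        ((dA.isLittleO.def hκ).and ?_))
      have : Tendsto (fun x => ‖A x - A xb‖) (𝓝 xb) (𝓝 ‖A xb - A xb‖) :=
        ((dA.continuousAt.tendsto).sub tendsto_const_nhds).norm
      exact this.eventually_lt_const (by simpa using hκ)
    have hpc : ∀ᶠ ε in 𝓝[>] (0:ℝ), p + ε • (ξ, -w) ∈ U := by
      have : Tendsto (fun ε : ℝ => p + ε • (ξ, -w)) (𝓝[>] 0) (𝓝 (p + (0:ℝ) • (ξ, -w))) :=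
        (Continuous.tendsto (by fun_prop) _).mono_left nhdsWithin_le_nhds
      rw [zero_smul, add_zero] at this
      exact this.eventually (mem_interior_iff_mem_nhds.1 h2)
    have hpU : p ∈ U := interior_subset h2
    have hq : ((xb, v1) : Ev n × Ev m) ∈ SKKT φ₀ Φ θ p.1 p.2 := by
      refine ⟨rfl, ?_⟩
      have : Φ xb + p.2 = z1 := by simp [hp]
      simp only [this]
      exact hgph
    have hex : ∀ ε : ℝ, ∃ q : Ev n × Ev m, 0 < ε → p + ε • (ξ, -w) ∈ U →
        q ∈ SKKT φ₀ Φ θ (p + ε • (ξ, -w)).1 (p + ε • (ξ, -w)).2 ∧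
        ‖q - (xb, v1)‖ ≤ c * M * ε := by
      intro ε
      by_cases hh : 0 < ε ∧ p + ε • (ξ, -w) ∈ U
      · obtain ⟨q', hq', hn⟩ := hS p hpU _ hh.2 (xb, v1) ⟨hq, h3⟩
        refine ⟨q', fun _ _ => ⟨hq', ?_⟩⟩
        rw [norm_sub_rev]
        refine hn.trans (le_of_eq ?_)
        rw [sub_add_cancel_left, norm_neg, norm_smul, Real.norm_of_nonneg hh.1.le]
        ring
      · exact ⟨0, fun h h' => absurd ⟨h, h'⟩ hh⟩
    choose q hqq using hex
    have hqall : ∀ᶠ ε in 𝓝[>] (0:ℝ), 0 < ε ∧ q ε ∈ SKKT φ₀ Φ θ (p + ε • (ξ, -w)).1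
        (p + ε • (ξ, -w)).2 ∧ ‖q ε - (xb, v1)‖ ≤ c * M * ε := by
      filter_upwards [hpc, self_mem_nhdsWithin] with ε e1 e2
      exact ⟨e2, hqq ε e2 e1⟩
    have hqt : Tendsto q (𝓝[>] 0) (𝓝 (xb, v1)) := by
      rw [tendsto_iff_norm_sub_tendsto_zero]
      refine tendsto_of_tendsto_of_tendsto_of_le_of_le' tendsto_const_nhds
        (h := fun ε : ℝ => c * M * ε) ?_
        (Eventually.of_forall fun _ => norm_nonneg _) (hqall.mono fun ε h => h.2.2)
      have : Tendsto (fun ε : ℝ => c * M * ε) (𝓝[>] 0) (𝓝 (c * M * 0)) :=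
        (Continuous.tendsto (by fun_prop) _).mono_left nhdsWithin_le_nhds
      simpa using this
    have hyt : Tendsto (fun ε : ℝ => (Φ (q ε).1 + (p + ε • (ξ, -w)).2, (q ε).2)) (𝓝[>] 0)
        (𝓝 (z1, v1)) := by
      have t1 : Tendsto (fun ε => Φ (q ε).1) (𝓝[>] 0) (𝓝 (Φ xb)) :=
        dPhi.continuousAt.tendsto.comp ((continuous_fst.tendsto _).comp hqt)
      have t2 : Tendsto (fun ε : ℝ => (p + ε • (ξ, -w)).2) (𝓝[>] 0)
          (𝓝 (p + (0:ℝ) • (ξ, -w)).2) :=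
        (Continuous.tendsto (by fun_prop) _).mono_left nhdsWithin_le_nhds
      have t3 : Tendsto (fun ε => (q ε).2) (𝓝[>] 0) (𝓝 v1) := (continuous_snd.tendsto _).comp hqt
      have := (t1.add t2).prodMk_nhds t3
      simpa [hp] using this
    obtain ⟨ε, ⟨hε, hqS, hqn⟩, ⟨b1, b2, b3, b4⟩, hl⟩ :=
      (hqall.and ((hqt.eventually hev).and (hyt.eventually hloc))).exists
    obtain ⟨k1, k2⟩ := hl hqS.2
    have k3 := hqS.1
    generalize q ε = qq at *
    obtain ⟨x', v'⟩ := qq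
    simp only [Prod.fst_add, Prod.smul_fst, Prod.snd_add, Prod.smul_snd, hp] at k1 k2 k3 b1 b2 b3 b4
    set dx := x' - xb with hdx
    set dv := v' - v1 with hdv
    set r := c * M * ε with hr
    have hr0 : 0 ≤ r := by positivity
    have hdxn : ‖dx‖ ≤ r := (norm_fst_le ((x', v') - (xb, v1))).trans hqn
    have hdvn : ‖dv‖ ≤ r := (norm_snd_le ((x', v') - (xb, v1))).trans hqn
    set e1 := Φ x' - Φ xb - fderiv ℝ Φ xb dx with he1
    set e2 := g x' - g xb - fderiv ℝ g xb dx with he2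
    set e3 := A x' - A xb - A' dx with he3
    have hb : ∀ {F : Type} [NormedAddCommGroup F] (e : F), ‖e‖ ≤ κ * ‖dx‖ → ‖e‖ ≤ κ * r :=
      fun e he => he.trans (mul_le_mul_of_nonneg_left hdxn hκ.le)
    have n1 : ‖e1‖ ≤ κ * r := hb _ b1
    have n2 : ‖e2‖ ≤ κ * r := hb _ b2
    have n3 : ‖e3‖ ≤ κ * r := hb _ b3
    have hess : ⟪ξ, fderiv ℝ g xb dx + A' dx vb⟫ = - ⟪w, fderiv ℝ Φ xb dx⟫ := by
      rw [← hess_eq vb hphi hPhi, ← hess_symm vb hphi hPhi, eq_neg_of_add_eq_zero_left hξw,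
        inner_neg_left]
      rw [hA]
      simp only [adjD, ContinuousLinearMap.adjoint_inner_left]
    have q1 : ε * ‖w‖ ^ 2 = ⟪w, fderiv ℝ Φ xb dx⟫ + ⟪w, e1⟫ := by
      have : Φ x' + (z1 - Φ xb + ε • -w) - z1 = fderiv ℝ Φ xb dx + e1 - ε • w := by
        rw [he1, smul_neg]; abel
      rw [this, inner_sub_right, inner_add_right, inner_smul_right, real_inner_self_eq_norm_sq] at k1
      linarith
    have q2 : ε * ‖ξ‖ ^ 2 = ⟪ξ, fderiv ℝ g xb dx + A' dx vb⟫ + ⟪ξ, e2 + e3 v1 + (A x' - A xb) dv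
        + A' dx (v1 - vb)⟫ := by
      have k4 : ε • ξ = fderiv ℝ g xb dx + A' dx vb + (e2 + e3 v1 + (A x' - A xb) dv
        + A' dx (v1 - vb)) + A xb dv := by
        have : ε • ξ = g x' + A x' v' - (g xb + A xb v1) := by rw [k3]; abel
        rw [this, he2, he3, hdv]
        simp only [_root_.sub_apply, map_sub]
        abel
      have k5 : ⟪ξ, A xb dv⟫ = 0 := by
        rw [← k2, hA]
        simp only [adjD, ContinuousLinearMap.adjoint_inner_right]
      rw [← real_inner_self_eq_norm_sq, ← inner_smul_right (𝕜 := ℝ), k4, inner_add_right,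
        inner_add_right, k5, add_zero]
    have bd1 : ⟪w, e1⟫ ≤ ‖w‖ * (κ * r) :=
      (real_inner_le_norm _ _).trans (mul_le_mul_of_nonneg_left n1 (norm_nonneg _))
    have hv1 : ‖v1‖ ≤ ‖vb‖ + 1 := by
      have : ‖v1‖ ≤ ‖v1 - vb‖ + ‖vb‖ := by simpa using norm_add_le (v1 - vb) vb
      linarith
    have m1 : ‖e3 v1‖ ≤ κ * r * (‖vb‖ + 1) :=
      (e3.le_opNorm v1).trans (mul_le_mul n3 hv1 (norm_nonneg _) (by positivity))
    have m2 : ‖(A x' - A xb) dv‖ ≤ κ * r :=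
      ((A x' - A xb).le_opNorm dv).trans (mul_le_mul b4.le hdvn (norm_nonneg _) (by positivity))
    have m3 : ‖A' dx (v1 - vb)‖ ≤ ‖A'‖ * r * κ :=
      ((A' dx).le_opNorm _).trans (mul_le_mul ((A'.le_opNorm dx).trans
        (mul_le_mul_of_nonneg_left hdxn (norm_nonneg _))) h1.le (norm_nonneg _) (by positivity))
    have m4 : ‖e2 + e3 v1 + (A x' - A xb) dv + A' dx (v1 - vb)‖ ≤
        κ * r + κ * r * (‖vb‖ + 1) + κ * r + ‖A'‖ * r * κ :=
      (norm_add_le _ _).trans (add_le_add ((norm_add_le _ _).trans (add_le_add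
        ((norm_add_le _ _).trans (add_le_add n2 m1)) m2)) m3)
    have bd2 := (real_inner_le_norm ξ (e2 + e3 v1 + (A x' - A xb) dv + A' dx (v1 - vb))).trans
      (mul_le_mul_of_nonneg_left m4 (norm_nonneg ξ))
    have fin : ε * (‖w‖ ^ 2 + ‖ξ‖ ^ 2) ≤ ε * (κ * C) := by
      have : ε * (κ * C) = ‖w‖ * (κ * r) + ‖ξ‖ * (κ * r + κ * r * (‖vb‖ + 1) + κ * r
          + ‖A'‖ * r * κ) := by
        rw [hC, hr]; ring
      rw [this]
      linarith
    exact le_of_mul_le_mul_left fin hε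
  have hz : ‖w‖ ^ 2 + ‖ξ‖ ^ 2 ≤ 0 := by
    have t : Tendsto (fun κ : ℝ => κ * C) (𝓝[>] 0) (𝓝 (0 * C)) :=
      (Continuous.tendsto (by fun_prop) _).mono_left nhdsWithin_le_nhds
    rw [zero_mul] at t
    refine ge_of_tendsto t ?_
    filter_upwards [Ioo_mem_nhdsGT (zero_lt_one' ℝ)] with κ hκ
    exact main κ hκ.1 hκ.2
  have z1 : ‖w‖ ^ 2 = 0 := by nlinarith [sq_nonneg ‖w‖, sq_nonneg ‖ξ‖]
  have z2 : ‖ξ‖ ^ 2 = 0 := by nlinarith [sq_nonneg ‖w‖, sq_nonneg ‖ξ‖]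
  simpa using And.intro z2 z1

/-- the Lipschitz-like property of the KKT solution map yields nondegeneracy,
uniqueness, and noncriticality of the multiplier. -/
theorem stmt18 {n m : ℕ} (θ : CPWL m) (φ₀ : Ev n → ℝ) (Φ : Ev n → Ev m)
    (xb : Ev n) (vb : Ev m)
    (hphi : ContDiffAt ℝ 2 φ₀ xb) (hPhi : ContDiffAt ℝ 2 Φ xb)
    (hvb : vb ∈ LamCom φ₀ Φ θ xb)
    (h0aff : (0 : Ev m) ∈ affineSpan ℝ (θ.subdiff (Φ xb)))
    (hll : LipschitzLike (fun p => SKKT φ₀ Φ θ p.1 p.2) (xb, vb)) :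
    (((affineSpan ℝ (θ.subdiff (Φ xb)) : Set (Ev m)) ∩
        {v : Ev m | adjD Φ xb v = 0}) = {0}) ∧
    LamCom φ₀ Φ θ xb = {vb} ∧ ¬ IsCriticalCom φ₀ Φ θ xb vb := by
  have nond : ∀ w ∈ affineSpan ℝ (θ.subdiff (Φ xb)), adjD Φ xb w = 0 → w = 0 := by
    intro w hw hker
    have hdir : w ∈ (affineSpan ℝ (θ.subdiff (Φ xb))).direction := by
      have := AffineSubspace.vsub_mem_direction hw h0aff
      simpa using this
    obtain ⟨v, hv, ε, hε, hp, hm⟩ := dir_lemma (θ.convex_subdiff _) hvb.2 hdir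
    refine (key_lemma θ φ₀ Φ xb vb hphi hPhi hvb hll 0 w (by simpa using hker) ?_).2
    have ht : Tendsto (fun t : ℝ => (Φ xb, (1 - t) • vb + t • v)) (𝓝[>] 0) (𝓝 (Φ xb, vb)) := by
      have : Tendsto (fun t : ℝ => (Φ xb, (1 - t) • vb + t • v)) (𝓝[>] 0)
          (𝓝 (Φ xb, (1 - (0:ℝ)) • vb + (0:ℝ) • v)) :=
        (Continuous.tendsto (by fun_prop) _).mono_left nhdsWithin_le_nhds
      simpa using this
    refine ht.frequently (Eventually.frequently ?_)
    filter_upwards [Ioo_mem_nhdsGT (zero_lt_one' ℝ)] with t ⟨t0, t1⟩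
    have cv : ∀ v' ∈ θ.subdiff (Φ xb), (1 - t) • vb + t • v' ∈ θ.subdiff (Φ xb) := fun v' hv' =>
      θ.convex_subdiff _ hvb.2 hv' (by linarith) t0.le (by ring)
    refine ⟨cv v hv, ?_⟩
    filter_upwards [θ.loc (Φ xb) ((1 - t) • vb + t • v)] with y hy hyg
    obtain ⟨l1, l2⟩ := hy hyg
    refine ⟨?_, by simp⟩
    have a1 := θ.mono l1 (cv _ hp)
    have a2 := θ.mono l1 (cv _ hm)
    have r1 : (1 - t) • vb + t • v - ((1 - t) • vb + t • (v + ε • w)) = (-(t * ε)) • w := by module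
    have r2 : (1 - t) • vb + t • v - ((1 - t) • vb + t • (v - ε • w)) = (t * ε) • w := by module
    rw [r1, inner_smul_left] at a1
    rw [r2, inner_smul_left] at a2
    simp only [conj_trivial] at a1 a2
    have hpos : 0 < t * ε := mul_pos t0 hε
    have : t * ε * ⟪w, y.1 - Φ xb⟫ = 0 := by linarith
    exact (mul_eq_zero.1 this).resolve_left hpos.ne'
  refine ⟨?_, ?_, ?_⟩
  · ext w
    simp only [mem_inter_iff, mem_singleton_iff]
    constructor
    · rintro ⟨h1, h2⟩
      exact nond w h1 h2
    · rintro rfl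
      exact ⟨h0aff, map_zero _⟩
  · ext v
    simp only [mem_singleton_iff]
    constructor
    · intro hv
      have h1 : v - vb ∈ affineSpan ℝ (θ.subdiff (Φ xb)) := by
        have hd := AffineSubspace.vsub_mem_direction (mem_affineSpan ℝ hv.2)
          (mem_affineSpan ℝ hvb.2)
        have := AffineSubspace.vadd_mem_of_mem_direction hd h0aff
        simpa using this
      refine sub_eq_zero.1 (nond _ h1 ?_)
      rw [map_sub]
      have e1 := hv.1
      have e2 := hvb.1
      rw [← e2] at e1
      rw [add_left_cancel e1, sub_self]
    · rintro rfl
      exact hvb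
  · rintro ⟨ξ, hξ, w, hw, he⟩
    refine hξ (key_lemma θ φ₀ Φ xb vb hphi hPhi hvb hll ξ w he ?_).1
    set u := fderiv ℝ Φ xb ξ with hu
    obtain ⟨t0, ht0, hT⟩ := θ.tan hw
    have ht : Tendsto (fun t : ℝ => (Φ xb + t • u, vb + t • w)) (𝓝[>] 0) (𝓝 (Φ xb, vb)) := by
      have : Tendsto (fun t : ℝ => (Φ xb + t • u, vb + t • w)) (𝓝[>] 0)
          (𝓝 (Φ xb + (0:ℝ) • u, vb + (0:ℝ) • w)) :=
        (Continuous.tendsto (by fun_prop) _).mono_left nhdsWithin_le_nhds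
      simpa using this
    refine ht.frequently (Eventually.frequently ?_)
    filter_upwards [Ioo_mem_nhdsGT ht0] with t ⟨h1, h2⟩
    have tI : t ∈ Icc 0 t0 := ⟨h1.le, h2.le⟩
    have I0 : (0:ℝ) ∈ Icc 0 t0 := ⟨le_rfl, ht0.le⟩
    have I1 : t0 ∈ Icc 0 t0 := ⟨ht0.le, le_rfl⟩
    refine ⟨hT t tI t tI, ?_⟩
    filter_upwards [θ.loc (Φ xb + t • u) (vb + t • w)] with y hy hyg
    obtain ⟨l1, l2⟩ := hy hyg
    have hd : 0 < t0 - t := sub_pos.2 h2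
    constructor
    · have a1 := θ.mono l1 (hT t tI 0 I0)
      have a2 := θ.mono l1 (hT t tI t0 I1)
      have r1 : vb + t • w - (vb + (0:ℝ) • w) = t • w := by module
      have r2 : vb + t • w - (vb + t0 • w) = (-(t0 - t)) • w := by module
      rw [r1, inner_smul_left] at a1
      rw [r2, inner_smul_left] at a2
      simp only [conj_trivial] at a1 a2
      exact le_antisymm (by nlinarith) (nonneg_of_mul_nonneg_right a1 h1)
    · have a1 := θ.mono l2 (hT 0 I0 t tI)
      have a2 := θ.mono l2 (hT t0 I1 t tI)
      have r1 : Φ xb + t • u - (Φ xb + (0:ℝ) • u) = t • u := by module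
      have r2 : Φ xb + t • u - (Φ xb + t0 • u) = (-(t0 - t)) • u := by module
      rw [r1, inner_smul_right, real_inner_comm] at a1
      rw [r2, inner_smul_right, real_inner_comm] at a2
      exact le_antisymm (by nlinarith) (nonneg_of_mul_nonneg_right a1 h1)
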